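/- Let N ∈ ℕ, λ > 0, δ > 0, and let V^X, V^Y ∈ ℝ^{N×N}. Define f_3 : ℝ^N → ℝ by f_3(x) = λ Σ_{n=1}^N √(([V^X x]_n)² + ([V^Y x]_n)² + δ²). Then f_3 is convex, differentiable on ℝ^N, bounded below by λNδ, and its gradient is Lipschitz continuous; in particular ∇f_3 is L-Lipschitz with L = (λ/δ)·(‖V^X‖² + ‖V^Y‖²), where ‖·‖ denotes the operator norm. -/

import Mathlib

lemma aux_cs (a b c d δ : ℝ) :
    a * c + b * d + δ ^ 2 ≤ Real.sqrt (a ^ 2 + b ^ 2 + δ ^ 2) * Real.sqrt (c ^ 2 + d ^ 2 + δ ^ 2) := by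
  rw [← Real.sqrt_mul (by positivity)]
  apply Real.le_sqrt_of_sq_le
  nlinarith [sq_nonneg (a * d - b * c), sq_nonneg (a * δ - δ * c), sq_nonneg (b * δ - δ * d)]

lemma aux_convex (a b c d δ p q : ℝ) (hp : 0 ≤ p) (hq : 0 ≤ q) (hpq : p + q = 1) :
    Real.sqrt ((p * a + q * c) ^ 2 + (p * b + q * d) ^ 2 + δ ^ 2) ≤
      p * Real.sqrt (a ^ 2 + b ^ 2 + δ ^ 2) + q * Real.sqrt (c ^ 2 + d ^ 2 + δ ^ 2) := by
  have h := aux_cs a b c d δ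
  have hs := Real.sq_sqrt (show 0 ≤ a ^ 2 + b ^ 2 + δ ^ 2 by positivity)
  have ht := Real.sq_sqrt (show 0 ≤ c ^ 2 + d ^ 2 + δ ^ 2 by positivity)
  apply Real.sqrt_le_iff.2 ⟨by positivity, ?_⟩
  have e : δ ^ 2 = (p + q) ^ 2 * δ ^ 2 := by rw [hpq]; ring
  have h2 := mul_le_mul_of_nonneg_left h (mul_nonneg hp hq)
  calc _ = p ^ 2 * (a ^ 2 + b ^ 2 + δ ^ 2) + q ^ 2 * (c ^ 2 + d ^ 2 + δ ^ 2)
        + 2 * (p * q * (a * c + b * d + δ ^ 2)) := by linear_combination e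
    _ ≤ p ^ 2 * (a ^ 2 + b ^ 2 + δ ^ 2) + q ^ 2 * (c ^ 2 + d ^ 2 + δ ^ 2)
        + 2 * (p * q * (Real.sqrt (a ^ 2 + b ^ 2 + δ ^ 2) * Real.sqrt (c ^ 2 + d ^ 2 + δ ^ 2))) := by
          linarith
    _ = _ := by rw [← hs, ← ht]; simp only [Real.sqrt_sq (Real.sqrt_nonneg _)]; ring

lemma aux_lip (a b c d δ s t : ℝ) (hδ : 0 < δ) (hs : δ ≤ s) (ht : δ ≤ t)
    (es : s ^ 2 = a ^ 2 + b ^ 2 + δ ^ 2) (et : t ^ 2 = c ^ 2 + d ^ 2 + δ ^ 2) :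
    (a / s - c / t) ^ 2 + (b / s - d / t) ^ 2 ≤ ((a - c) ^ 2 + (b - d) ^ 2) / δ ^ 2 := by
  have hs0 : 0 < s := by linarith
  have ht0 : 0 < t := by linarith
  calc (a / s - c / t) ^ 2 + (b / s - d / t) ^ 2
      ≤ (a / s - c / t) ^ 2 + (b / s - d / t) ^ 2 + (δ / s - δ / t) ^ 2 := by
        linarith [sq_nonneg (δ / s - δ / t)]
    _ = (((a - c) ^ 2 + (b - d) ^ 2) - (s - t) ^ 2) / (s * t) := by
        field_simp
        linear_combination (-t ^ 2 + s * t) * es + (-s ^ 2 + s * t) * et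
    _ ≤ ((a - c) ^ 2 + (b - d) ^ 2) / (s * t) := by
        gcongr
        linarith [sq_nonneg (s - t)]
    _ ≤ _ := by
        gcongr
        nlinarith

lemma aux_pair (a b c d δ s t w z : ℝ) (hδ : 0 < δ) (hs : δ ≤ s) (ht : δ ≤ t)
    (es : s ^ 2 = a ^ 2 + b ^ 2 + δ ^ 2) (et : t ^ 2 = c ^ 2 + d ^ 2 + δ ^ 2) :
    (a * w + b * z) / s - (c * w + d * z) / t ≤
      1 / δ * (Real.sqrt ((a - c) ^ 2 + (b - d) ^ 2) * Real.sqrt (w ^ 2 + z ^ 2)) := by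
  have h := aux_lip a b c d δ s t hδ hs ht es et
  have e : (a * w + b * z) / s - (c * w + d * z) / t
      = (a / s - c / t) * w + (b / s - d / t) * z := by ring
  rw [e, ← Real.sqrt_mul (by positivity)]
  have : 1 / δ = Real.sqrt (1 / δ ^ 2) := by
    rw [Real.sqrt_div zero_le_one, Real.sqrt_one, Real.sqrt_sq hδ.le]
  rw [this, ← Real.sqrt_mul (by positivity)]
  apply Real.le_sqrt_of_sq_le
  generalize a / s - c / t = u at *
  generalize b / s - d / t = v at *
  calc (u * w + v * z) ^ 2 ≤ (u ^ 2 + v ^ 2) * (w ^ 2 + z ^ 2) := by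
        nlinarith [sq_nonneg (u * z - v * w)]
    _ ≤ ((a - c) ^ 2 + (b - d) ^ 2) / δ ^ 2 * (w ^ 2 + z ^ 2) := by gcongr
    _ = _ := by ring

lemma aux_opn {N : ℕ} (A B : EuclideanSpace ℝ (Fin N) →L[ℝ] EuclideanSpace ℝ (Fin N))
    (h : EuclideanSpace ℝ (Fin N)) :
    Real.sqrt (∑ n, ((A h n) ^ 2 + (B h n) ^ 2)) ≤ Real.sqrt (‖A‖ ^ 2 + ‖B‖ ^ 2) * ‖h‖ := by
  rw [Finset.sum_add_distrib, ← EuclideanSpace.real_norm_sq_eq, ← EuclideanSpace.real_norm_sq_eq]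
  apply Real.sqrt_le_iff.2 ⟨by positivity, ?_⟩
  rw [mul_pow, Real.sq_sqrt (by positivity), add_mul, ← mul_pow, ← mul_pow]
  gcongr <;> exact ContinuousLinearMap.le_opNorm _ _

lemma aux_main (N : ℕ) (lam δ : ℝ) (hlam : 0 < lam) (hδ : 0 < δ)
    (A B : EuclideanSpace ℝ (Fin N) →L[ℝ] EuclideanSpace ℝ (Fin N))
    (f3 : EuclideanSpace ℝ (Fin N) → ℝ)
    (hf3 : ∀ x, f3 x = lam * ∑ n, Real.sqrt ((A x n) ^ 2 + (B x n) ^ 2 + δ ^ 2)) :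
    ConvexOn ℝ Set.univ f3 ∧
    Differentiable ℝ f3 ∧
    (∀ x, lam * N * δ ≤ f3 x) ∧
    (∀ x y, ‖gradient f3 x - gradient f3 y‖
      ≤ (lam / δ) * (‖A‖ ^ 2 + ‖B‖ ^ 2) * ‖x - y‖) := by
  have hge : ∀ a b : ℝ, δ ≤ Real.sqrt (a ^ 2 + b ^ 2 + δ ^ 2) := fun a b =>
    Real.le_sqrt_of_sq_le (by nlinarith [sq_nonneg a, sq_nonneg b])
  have hd1 : ∀ x, ∃ D : EuclideanSpace ℝ (Fin N) →L[ℝ] ℝ, HasFDerivAt f3 D x ∧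
      ∀ h, D h = lam * ∑ n, (A x n * A h n + B x n * B h n)
        / Real.sqrt ((A x n) ^ 2 + (B x n) ^ 2 + δ ^ 2) := by
    intro x
    have hA : ∀ (C : EuclideanSpace ℝ (Fin N) →L[ℝ] EuclideanSpace ℝ (Fin N)) (n : Fin N),
        HasFDerivAt (fun x => C x n) ((EuclideanSpace.proj n).comp C : _ →L[ℝ] ℝ) x :=
      fun C n => ((EuclideanSpace.proj n).comp C : _ →L[ℝ] ℝ).hasFDerivAt
    have hn := fun n : Fin N => ((((hA A n).pow 2).add ((hA B n).pow 2)).add_const (δ ^ 2)).sqrt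
      (by simp only [Pi.add_apply]; positivity)
    have hs := (HasFDerivAt.fun_sum (u := Finset.univ) (fun n _ => hn n)).const_mul lam
    refine ⟨_, (hs.congr_of_eventuallyEq (Filter.Eventually.of_forall fun y => ?_)), ?_⟩
    · simp [hf3]
    · intro h
      simp only [ContinuousLinearMap.smul_apply, ContinuousLinearMap.sum_apply, smul_eq_mul]
      congr 1
      refine Finset.sum_congr rfl fun n _ => ?_
      simp
      field_simp
  have hd : Differentiable ℝ f3 := fun x => (hd1 x).choose_spec.1.differentiableAt
  refine ⟨⟨convex_univ, ?_⟩, hd, ?_, ?_⟩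
  · intro x _ y _ p q hp hq hpq
    rw [hf3, hf3, hf3]
    have : ∑ n, Real.sqrt ((A (p • x + q • y) n) ^ 2 + (B (p • x + q • y) n) ^ 2 + δ ^ 2) ≤
        ∑ n, (p * Real.sqrt ((A x n) ^ 2 + (B x n) ^ 2 + δ ^ 2)
          + q * Real.sqrt ((A y n) ^ 2 + (B y n) ^ 2 + δ ^ 2)) := by
      refine Finset.sum_le_sum fun n _ => ?_
      have := aux_convex (A x n) (B x n) (A y n) (B y n) δ p q hp hq hpq
      simpa using this
    rw [Finset.sum_add_distrib, ← Finset.mul_sum, ← Finset.mul_sum] at this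
    have := mul_le_mul_of_nonneg_left this hlam.le
    simp only [smul_eq_mul]
    linarith
  · intro x
    rw [hf3, mul_assoc]
    gcongr
    have := Finset.sum_le_sum (s := Finset.univ) fun (n : Fin N) _ => hge (A x n) (B x n)
    simpa using this
  · intro x y
    have hg : ∀ x h, inner ℝ (gradient f3 x) h = lam * ∑ n, (A x n * A h n + B x n * B h n)
        / Real.sqrt ((A x n) ^ 2 + (B x n) ^ 2 + δ ^ 2) := by
      intro x h
      obtain ⟨D, hD, hDh⟩ := hd1 x
      rw [← hDh, gradient, InnerProductSpace.toDual_symm_apply, hD.fderiv]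
    have key : ∀ h, inner ℝ (gradient f3 x - gradient f3 y) h
        ≤ (lam / δ) * (‖A‖ ^ 2 + ‖B‖ ^ 2) * ‖x - y‖ * ‖h‖ := by
      intro h
      rw [inner_sub_left, hg, hg, ← mul_sub, ← Finset.sum_sub_distrib]
      have h1 : ∑ n, ((A x n * A h n + B x n * B h n)
            / Real.sqrt ((A x n) ^ 2 + (B x n) ^ 2 + δ ^ 2)
          - (A y n * A h n + B y n * B h n)
            / Real.sqrt ((A y n) ^ 2 + (B y n) ^ 2 + δ ^ 2))
          ≤ ∑ n, 1 / δ * (Real.sqrt ((A (x - y) n) ^ 2 + (B (x - y) n) ^ 2)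
            * Real.sqrt ((A h n) ^ 2 + (B h n) ^ 2)) := by
        refine Finset.sum_le_sum fun n _ => ?_
        have := aux_pair (A x n) (B x n) (A y n) (B y n) δ _ _ (A h n) (B h n) hδ
          (hge _ _) (hge _ _) (Real.sq_sqrt (by positivity)) (Real.sq_sqrt (by positivity))
        simpa only [map_sub, PiLp.sub_apply] using this
      rw [← Finset.mul_sum] at h1
      have h2 := Real.sum_sqrt_mul_sqrt_le (Finset.univ : Finset (Fin N))
        (f := fun n => (A (x - y) n) ^ 2 + (B (x - y) n) ^ 2)
        (g := fun n => (A h n) ^ 2 + (B h n) ^ 2) (fun n => by positivity) (fun n => by positivity)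
      have h3 := mul_le_mul (aux_opn A B (x - y)) (aux_opn A B h) (Real.sqrt_nonneg _)
        (by positivity)
      have h4 := mul_le_mul_of_nonneg_left (h2.trans h3) (show 0 ≤ 1 / δ by positivity)
      have h5 := mul_le_mul_of_nonneg_left (h1.trans h4) hlam.le
      refine h5.trans (le_of_eq ?_)
      have h6 := Real.mul_self_sqrt (show 0 ≤ ‖A‖ ^ 2 + ‖B‖ ^ 2 by positivity)
      linear_combination (lam / δ * ‖x - y‖ * ‖h‖) * h6
    have hk := key (gradient f3 x - gradient f3 y)
    rw [real_inner_self_eq_norm_mul_norm] at hk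
    rcases (norm_nonneg (gradient f3 x - gradient f3 y)).eq_or_lt with h0 | h0
    · rw [← h0]; positivity
    · exact le_of_mul_le_mul_right hk h0

/-- The smoothed isotropic total-variation regularizer
`f₃(x) = λ Σₙ √(([Vˣx]ₙ)² + ([Vʸx]ₙ)² + δ²)` (with `λ, δ > 0`) is convex, differentiable,
bounded below by `λNδ`, and has an `L`-Lipschitz gradient with
`L = (λ/δ)(‖Vˣ‖² + ‖Vʸ‖²)`, `‖·‖` being the (Euclidean) operator norm. -/
theorem stmt10 (N : ℕ) (lam δ : ℝ) (hlam : 0 < lam) (hδ : 0 < δ)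
    (VX VY : Matrix (Fin N) (Fin N) ℝ)
    (f3 : EuclideanSpace ℝ (Fin N) → ℝ)
    (hf3 : ∀ x, f3 x
      = lam * ∑ n, Real.sqrt ((VX.mulVec x n) ^ 2 + (VY.mulVec x n) ^ 2 + δ ^ 2)) :
    ConvexOn ℝ Set.univ f3 ∧
    Differentiable ℝ f3 ∧
    (∀ x, lam * N * δ ≤ f3 x) ∧
    (∀ x y, ‖gradient f3 x - gradient f3 y‖
      ≤ (lam / δ) * (‖LinearMap.toContinuousLinearMap (Matrix.toEuclideanLin VX)‖ ^ 2
          + ‖LinearMap.toContinuousLinearMap (Matrix.toEuclideanLin VY)‖ ^ 2) * ‖x - y‖) := by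
  exact aux_main N lam δ hlam hδ (LinearMap.toContinuousLinearMap (Matrix.toEuclideanLin VX))
    (LinearMap.toContinuousLinearMap (Matrix.toEuclideanLin VY)) f3 hf3
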